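/- The consistency problem for the class of all modular lattices is unsolvable: the set of conjunctions of lattice equations that admit a non-trivial satisfying assignment in some modular lattice is not decidable (there is no algorithm which, given a conjunction of lattice equations, decides whether some modular lattice contains elements not all equal that satisfy all its equations). -/

import Mathlib

/-- Lattice terms in countably many variables. -/
inductive LatTerm : Type where
  | var : ℕ → LatTerm
  | sup : LatTerm → LatTerm → LatTerm
  | inf : LatTerm → LatTerm → LatTerm

/-- Evaluation of a lattice term under an assignment `v`. -/
def LatTerm.eval {L : Type*} [Lattice L] (v : ℕ → L) : LatTerm → L
  | .var i => v i
  | .sup s t => s.eval v ⊔ t.eval v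
  | .inf s t => s.eval v ⊓ t.eval v

/-- The variables occurring in a lattice term. -/
def LatTerm.vars : LatTerm → Finset ℕ
  | .var i => {i}
  | .sup s t => s.vars ∪ t.vars
  | .inf s t => s.vars ∪ t.vars

/-- An injective Gödel numbering of lattice terms. -/
def LatTerm.code : LatTerm → ℕ
  | .var i => 3 * i
  | .sup s t => 3 * Nat.pair s.code t.code + 1
  | .inf s t => 3 * Nat.pair s.code t.code + 2

/-- A conjunction of lattice equations `s = t`, as a finite list of pairs. -/
abbrev LatConj : Type := List (LatTerm × LatTerm)

/-- The variables occurring in a conjunction of lattice equations. -/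
def LatConj.vars (Φ : LatConj) : Finset ℕ :=
  Φ.foldr (fun p s => p.1.vars ∪ p.2.vars ∪ s) ∅

/-- A (natural) Gödel numbering of conjunctions of lattice equations. -/
def LatConj.code (Φ : LatConj) : ℕ :=
  Encodable.encode (Φ.map fun p => Nat.pair p.1.code p.2.code)

/-- `Φ` is satisfied by the assignment `v`. -/
def LatConj.Sat {L : Type*} [Lattice L] (Φ : LatConj) (v : ℕ → L) : Prop :=
  ∀ p ∈ Φ, p.1.eval v = p.2.eval v

/-- The assignment `v` is non-trivial for `Φ`: not all (occurring) variables get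
the same value. -/
def LatConj.Nontriv {L : Type*} (Φ : LatConj) (v : ℕ → L) : Prop :=
  ∃ i ∈ Φ.vars, ∃ j ∈ Φ.vars, v i ≠ v j


namespace LatticeMachine

open Function

section RelImage

variable {L : Type*} [Lattice L]

/-- The image in `B` of an element `u` under the relation encoded by `r`. -/
def relImage (r B u : L) : L := (u ⊔ r) ⊓ B

lemma relImage_mono (r B : L) : Monotone (relImage r B) :=
  fun _ _ h => inf_le_inf_right B (sup_le_sup_right h r)

lemma relImage_le (r B u : L) : relImage r B u ≤ B := inf_le_right

/-- `r` encodes an injective, everywhere defined relation from `A` to `B`, relative to the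
zero element `z`. -/
structure IsGraph (z A B r : L) : Prop where
  le_sup : r ≤ A ⊔ B
  dom : A ≤ B ⊔ r
  inj : r ⊓ A ≤ z

lemma le_relImage {z B r u : L} (hB : z ≤ B) (hz : z ≤ u) : z ≤ relImage r B u :=
  le_inf (hz.trans le_sup_left) hB

variable [IsModularLattice L]

lemma IsGraph.relImage_relImage {z A B r u : L} (h : IsGraph z A B r) (hz : z ≤ u) (hu : u ≤ A) :
    relImage r A (relImage r B u) = u := by
  have h₁ : (u ⊔ r) ⊓ B ⊔ r = u ⊔ r := by
    rw [inf_sup_assoc_of_le B (le_sup_right : r ≤ u ⊔ r), inf_eq_left]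
    exact sup_le (hu.trans h.dom) le_sup_right
  rw [relImage, relImage, h₁, sup_inf_assoc_of_le r hu, sup_eq_left]
  exact h.inj.trans hz

lemma relImage_comp {A B E x y u : L} (hind : (A ⊔ B) ⊓ (B ⊔ E) ≤ B) (hx : x ≤ A ⊔ B)
    (hy : y ≤ B ⊔ E) (hu : u ≤ A) :
    relImage y E (relImage x B u) = relImage ((x ⊔ y) ⊓ (A ⊔ E)) E u := by
  have h₁ : (u ⊔ x ⊔ y) ⊓ (B ⊔ E) = (u ⊔ x) ⊓ B ⊔ y := by
    rw [sup_comm (u ⊔ x) y, sup_inf_assoc_of_le _ hy, sup_comm]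
    congr 1
    refine le_antisymm (le_inf inf_le_left (le_trans ?_ hind)) (inf_le_inf_left _ le_sup_left)
    exact inf_le_inf_right _ (sup_le (hu.trans le_sup_left) hx)
  have h₂ : u ⊔ (x ⊔ y) ⊓ (A ⊔ E) = (u ⊔ x ⊔ y) ⊓ (A ⊔ E) := by
    rw [← sup_inf_assoc_of_le _ (hu.trans le_sup_left), sup_assoc]
  rw [relImage, relImage, relImage, ← h₁, h₂, inf_assoc, inf_assoc,
    inf_eq_right.2 (le_sup_right : E ≤ B ⊔ E), inf_eq_right.2 (le_sup_right : E ≤ A ⊔ E)]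

end RelImage

/-- Horn clauses about unary predicates (named by `ι`) on families of stacks indexed by `K`
with entries in `G`. -/
inductive Clause (ι K G : Type) : Type
  /-- `P` holds for the empty stacks. -/
  | base (P : ι)
  /-- `P` and `P'` imply `Q`. -/
  | meet (P P' Q : ι)
  /-- If `P` holds before pushing `g` on stack `k`, then `Q` holds afterwards. -/
  | push (k : K) (g : G) (P Q : ι)
  /-- If `P` holds after pushing `g` on stack `k`, then `Q` holds before. -/
  | pop (k : K) (g : G) (P Q : ι)
deriving Fintype

/-- Names for the lattice elements used to interpret clauses. -/
inductive Name (ι K G : Type) : Type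
  | bot
  | objA
  | objB
  | objE
  | idAB
  | idBE
  | fold
  | origin
  | stepAB (k : K) (g : G)
  | stepBE (k : K) (g : G)
  | pred (P : ι)
deriving Fintype

section Derivation

variable {ι K G : Type} [DecidableEq K]

/-- Pushing an element on a stack. -/
def pushStack (k : K) (g : G) (y : K → List G) : K → List G := update y k (g :: y k)

lemma pushStack_injective (k : K) (g : G) : Injective (pushStack (G := G) k g) := by
  intro y y' h
  funext l
  have hl := congrFun h l
  by_cases e : l = k
  · subst e
    simpa [pushStack] using hl
  · simpa [pushStack, e] using hl

lemma pushStack_comm {k l : K} (h : k ≠ l) (g g' : G) (y : K → List G) :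
    pushStack k g (pushStack l g' y) = pushStack l g' (pushStack k g y) := by
  simp only [pushStack, update_of_ne h, update_of_ne h.symm]
  exact update_comm h.symm _ _ _

lemma pushStack_update {k : K} {g : G} {l : List G} {y : K → List G} (h : y k = g :: l) :
    pushStack k g (update y k l) = y := by
  simp [pushStack, ← h]

/-- The facts derivable by the clauses in `C` from the fact that `P₀` holds for `y₀`. -/
inductive Derives (C : Set (Clause ι K G)) (P₀ : ι) (y₀ : K → List G) : ι → (K → List G) → Prop
  | start : Derives C P₀ y₀ P₀ y₀
  | base {P} : Clause.base P ∈ C → Derives C P₀ y₀ P (fun _ => [])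
  | meet {P P' Q y} : Clause.meet P P' Q ∈ C → Derives C P₀ y₀ P y → Derives C P₀ y₀ P' y →
      Derives C P₀ y₀ Q y
  | push {k g P Q y} : Clause.push k g P Q ∈ C → Derives C P₀ y₀ P y →
      Derives C P₀ y₀ Q (pushStack k g y)
  | pop {k g P Q y} : Clause.pop k g P Q ∈ C → Derives C P₀ y₀ P (pushStack k g y) →
      Derives C P₀ y₀ Q y

end Derivation

section Model

variable {ι K G : Type} {L : Type*} [Lattice L]

open Name

/-- The action of pushing `g` on stack `k` on lattice elements below `objA`. -/
def shift (w : Name ι K G → L) (k : K) (g : G) (u : L) : L :=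
  relImage (w idAB) (w objA) (relImage (w (stepAB k g)) (w objB) u)

/-- Validity of a clause for an interpretation of the names. -/
def Clause.Holds (w : Name ι K G → L) : Clause ι K G → Prop
  | .base P => w origin ≤ w (pred P)
  | .meet P P' Q => w (pred P) ⊓ w (pred P') ≤ w (pred Q)
  | .push k g P Q => shift w k g (w (pred P)) ≤ w (pred Q)
  | .pop k g P Q => w (pred P) ⊓ shift w k g (w objA) ≤ shift w k g (w (pred Q))

/-- Interpretations of the names in a lattice which satisfy the clauses in `C` and
for which the predicate `bad` is empty. -/
structure IsModel (C : Set (Clause ι K G)) (bad : ι) (w : Name ι K G → L) : Prop where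
  bot_le : ∀ x, w bot ≤ w x
  le_top : ∀ x, w x ≤ w objA ⊔ w objB ⊔ w objE
  pred_le : ∀ P, w (pred P) ≤ w objA
  origin_le : w origin ≤ w objA
  indep : (w objA ⊔ w objB) ⊓ (w objB ⊔ w objE) ≤ w objB
  graph_AB : IsGraph (w bot) (w objA) (w objB) (w idAB)
  graph_BA : IsGraph (w bot) (w objB) (w objA) (w idAB)
  graph_BE : IsGraph (w bot) (w objB) (w objE) (w idBE)
  graph_EB : IsGraph (w bot) (w objE) (w objB) (w idBE)
  graph_step : ∀ k g, IsGraph (w bot) (w objA) (w objB) (w (stepAB k g))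
  stepBE_le : ∀ k g, w (stepBE k g) ≤ w objB ⊔ w objE
  step_eq : ∀ k g, (w idAB ⊔ w (stepBE k g)) ⊓ (w objA ⊔ w objE) =
    (w (stepAB k g) ⊔ w idBE) ⊓ (w objA ⊔ w objE)
  step_comm : ∀ k g l h, k ≠ l → (w (stepAB k g) ⊔ w (stepBE l h)) ⊓ (w objA ⊔ w objE) =
    (w (stepAB l h) ⊔ w (stepBE k g)) ⊓ (w objA ⊔ w objE)
  fold_dom : w objB ≤ w origin ⊔ w fold
  fold_inj : w fold ⊓ w objB ≤ w bot
  holds : ∀ c ∈ C, c.Holds w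
  bad_le : w (pred bad) ≤ w bot

/-- The element `x` represents the stacks `y`. -/
inductive Represents [DecidableEq K] (w : Name ι K G → L) : (K → List G) → L → Prop
  | origin : Represents w (fun _ => []) (w origin)
  | push {y x} (k : K) (g : G) : Represents w y x → Represents w (pushStack k g y) (shift w k g x)

lemma shift_le (w : Name ι K G → L) (k : K) (g : G) (u : L) : shift w k g u ≤ w objA :=
  relImage_le _ _ _

lemma shift_mono (w : Name ι K G → L) (k : K) (g : G) : Monotone (shift w k g) :=
  (relImage_mono _ _).comp (relImage_mono _ _)

namespace IsModel

variable {C : Set (Clause ι K G)} {bad : ι} {w : Name ι K G → L}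

lemma bot_le_shift (H : IsModel C bad w) {k : K} {g : G} {u : L} (hz : w bot ≤ u) :
    w bot ≤ shift w k g u :=
  le_relImage (H.bot_le _) (le_relImage (H.bot_le _) hz)

lemma eq_bot_of_origin_le (H : IsModel C bad w) (h : w origin ≤ w bot) (x : Name ι K G) :
    w x = w bot := by
  have cancel : ∀ {p q r : L}, w bot ≤ r → q ≤ p ⊔ r → r ⊓ q ≤ w bot → p ≤ w bot → q ≤ w bot :=
    fun hr hq hrq hp => (le_inf (hq.trans (sup_le (hp.trans hr) le_rfl)) le_rfl).trans hrq
  have hB := cancel (H.bot_le _) H.fold_dom H.fold_inj h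
  have hA := cancel (H.bot_le _) H.graph_AB.dom H.graph_AB.inj hB
  have hE := cancel (H.bot_le _) H.graph_EB.dom H.graph_EB.inj hB
  exact le_antisymm ((H.le_top x).trans (sup_le (sup_le hA hB) hE)) (H.bot_le x)

lemma bounds_of_represents [DecidableEq K] (H : IsModel C bad w) {y : K → List G} {x : L}
    (h : Represents w y x) : w bot ≤ x ∧ x ≤ w objA := by
  induction h with
  | origin => exact ⟨H.bot_le _, H.origin_le⟩
  | push k g _ ih => exact ⟨H.bot_le_shift ih.1, relImage_le _ _ _⟩

variable [IsModularLattice L]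

lemma exists_leftInverse_shift (H : IsModel C bad w) (k : K) (g : G) :
    ∃ r : L → L, Monotone r ∧ ∀ u, w bot ≤ u → u ≤ w objA → r (shift w k g u) = u := by
  refine ⟨fun u => relImage (w (stepAB k g)) (w objA) (relImage (w idAB) (w objB) u),
    (relImage_mono _ _).comp (relImage_mono _ _), fun u hz hu => ?_⟩
  simp only [shift]
  rw [H.graph_BA.relImage_relImage (le_relImage (H.bot_le _) hz) (relImage_le _ _ _),
    (H.graph_step k g).relImage_relImage hz hu]

lemma shift_comm (H : IsModel C bad w) {k l : K} (hkl : k ≠ l) (g h : G) {u : L}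
    (hz : w bot ≤ u) (hu : u ≤ w objA) :
    shift w k g (shift w l h u) = shift w l h (shift w k g u) := by
  have key : ∀ k g l h, relImage (w idBE) (w objE)
      (relImage (w (stepAB k g)) (w objB) (shift w l h u)) =
      relImage ((w (stepAB l h) ⊔ w (stepBE k g)) ⊓ (w objA ⊔ w objE)) (w objE) u := by
    intro k g l h
    rw [relImage_comp H.indep (H.graph_step k g).le_sup H.graph_BE.le_sup (shift_le w l h u),
      ← H.step_eq, ← relImage_comp H.indep H.graph_AB.le_sup (H.stepBE_le k g)
        (shift_le w l h u), shift, H.graph_BA.relImage_relImage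
        (le_relImage (H.bot_le _) hz) (relImage_le _ _ _),
      relImage_comp H.indep (H.graph_step l h).le_sup (H.stepBE_le k g) hu]
  have hkey := key k g l h
  rw [H.step_comm l h k g hkl.symm, ← key l h k g] at hkey
  have hcancel : relImage (w (stepAB k g)) (w objB) (shift w l h u) =
      relImage (w (stepAB l h)) (w objB) (shift w k g u) := by
    have := congrArg (relImage (w idBE) (w objB)) hkey
    rwa [H.graph_BE.relImage_relImage
      (le_relImage (H.bot_le _) (H.bot_le_shift hz)) (relImage_le _ _ _),
      H.graph_BE.relImage_relImage
      (le_relImage (H.bot_le _) (H.bot_le_shift hz)) (relImage_le _ _ _)] at this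
  rw [shift, hcancel]
  rfl

variable [DecidableEq K]

lemma exists_of_represents_cons (H : IsModel C bad w) {y : K → List G} {x : L}
    (h : Represents w y x) {k : K} {g : G} {l : List G} (hk : y k = g :: l) :
    ∃ x', Represents w (update y k l) x' ∧ x = shift w k g x' := by
  induction h with
  | origin => simp at hk
  | @push y x k' g' hx ih =>
    by_cases e : k = k'
    · subst e
      simp only [pushStack, update_self, List.cons.injEq] at hk
      obtain ⟨rfl, rfl⟩ := hk
      exact ⟨x, by simpa [pushStack] using hx, rfl⟩
    · simp only [pushStack, update_of_ne e] at hk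
      obtain ⟨x', hx', rfl⟩ := ih hk
      have hb := H.bounds_of_represents hx'
      refine ⟨shift w k' g' x', ?_, H.shift_comm (Ne.symm e) _ _ hb.1 hb.2⟩
      have := hx'.push k' g'
      simp only [pushStack, update_of_ne (Ne.symm e)] at this ⊢
      rwa [update_comm (Ne.symm e)]

lemma represents_unique (H : IsModel C bad w) {y : K → List G} {x x' : L}
    (h : Represents w y x) (h' : Represents w y x') : x = x' := by
  induction h generalizing x' with
  | origin =>
    generalize hy : (fun _ => [] : K → List G) = y at h'
    cases h' with
    | origin => rfl
    | push k g _ => simpa [pushStack] using congrFun hy k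
  | @push y x k g hx ih =>
    obtain ⟨x₁, hx₁, rfl⟩ := H.exists_of_represents_cons (k := k) (g := g)
      (l := y k) h' (by simp [pushStack])
    rw [ih (by simpa [pushStack] using hx₁)]

lemma le_pred_of_derives (H : IsModel C bad w) {P₀ : ι} {y₀ : K → List G} {x₀ : L}
    (h₀ : Represents w y₀ x₀) (hP₀ : x₀ ≤ w (pred P₀)) {P : ι} {y : K → List G}
    (h : Derives C P₀ y₀ P y) : ∃ x, Represents w y x ∧ x ≤ w (pred P) := by
  induction h with
  | start => exact ⟨x₀, h₀, hP₀⟩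
  | base hc => exact ⟨_, .origin, H.holds _ hc⟩
  | meet hc _ _ ih ih' =>
    obtain ⟨x, hx, hxP⟩ := ih
    obtain ⟨x', hx', hxP'⟩ := ih'
    obtain rfl := H.represents_unique hx hx'
    exact ⟨x, hx, (le_inf hxP hxP').trans (H.holds _ hc)⟩
  | push hc _ ih =>
    obtain ⟨x, hx, hxP⟩ := ih
    exact ⟨_, hx.push _ _, (shift_mono w _ _ hxP).trans (H.holds _ hc)⟩
  | @pop k g P Q y hc _ ih =>
    obtain ⟨x, hx, hxP⟩ := ih
    obtain ⟨x', hx', rfl⟩ := H.exists_of_represents_cons (k := k) (g := g)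
      (l := y k) hx (by simp [pushStack])
    obtain ⟨r, hr, hr'⟩ := H.exists_leftInverse_shift k g
    refine ⟨x', by simpa [pushStack] using hx', ?_⟩
    have hb := H.bounds_of_represents hx'
    have := hr ((le_inf hxP (shift_mono w k g hb.2)).trans (H.holds _ hc))
    rwa [hr' _ hb.1 hb.2, hr' _ (H.bot_le _) (H.pred_le _)] at this

lemma origin_le_bot (H : IsModel C bad w) {y : K → List G} {x : L}
    (h : Represents w y x) (hx : x ≤ w bot) : w origin ≤ w bot := by
  induction h with
  | origin => exact hx
  | push k g h ih =>
    obtain ⟨r, hr, hr'⟩ := H.exists_leftInverse_shift k g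
    have hb := H.bounds_of_represents h
    refine ih ?_
    have := hr (hx.trans (H.bot_le_shift (k := k) (g := g) le_rfl))
    rwa [hr' _ hb.1 hb.2, hr' _ le_rfl (H.bot_le _)] at this

/-- If the predicate `bad` is derivable for some stacks, then every model is trivial. -/
lemma eq_bot_of_derives (H : IsModel C bad w) {P₀ : ι} {y₀ y : K → List G} {x₀ : L}
    (h₀ : Represents w y₀ x₀) (hP₀ : x₀ ≤ w (pred P₀)) (h : Derives C P₀ y₀ bad y)
    (x : Name ι K G) : w x = w bot := by
  obtain ⟨x₁, hx₁, hle⟩ := H.le_pred_of_derives h₀ hP₀ h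
  exact H.eq_bot_of_origin_le (H.origin_le_bot hx₁ (hle.trans H.bad_le)) x

end IsModel

end Model

section Submodules

variable {M : Type} [AddCommGroup M] [Module ℚ M]

/-- The submodule `N` of the first summand. -/
def inA (N : Submodule ℚ M) : Submodule ℚ (M × M × M) := N.prod ⊥

/-- The second summand. -/
def sumB : Submodule ℚ (M × M × M) := (⊥ : Submodule ℚ M).prod ((⊤ : Submodule ℚ M).prod ⊥)

/-- The third summand. -/
def sumE : Submodule ℚ (M × M × M) := (⊥ : Submodule ℚ M).prod ((⊥ : Submodule ℚ M).prod ⊤)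

/-- The graph of a linear map from the first to the second summand. -/
def graphAB (f : M →ₗ[ℚ] M) : Submodule ℚ (M × M × M) :=
  LinearMap.range (LinearMap.id.prod (f.prod 0))

/-- The graph of a linear map from the second to the third summand. -/
def graphBE (f : M →ₗ[ℚ] M) : Submodule ℚ (M × M × M) :=
  LinearMap.range ((0 : M →ₗ[ℚ] M).prod (LinearMap.id.prod f))

/-- The graph of a linear map from the second to the first summand. -/
def graphBA (f : M →ₗ[ℚ] M) : Submodule ℚ (M × M × M) :=
  LinearMap.range (f.prod (LinearMap.id.prod (0 : M →ₗ[ℚ] M)))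

lemma mem_inA {N : Submodule ℚ M} {x : M × M × M} :
    x ∈ inA N ↔ x.1 ∈ N ∧ x.2.1 = 0 ∧ x.2.2 = 0 := by
  simp [inA, Submodule.mem_prod, Prod.ext_iff]

lemma mem_sumB {x : M × M × M} : x ∈ (sumB : Submodule ℚ (M × M × M)) ↔ x.1 = 0 ∧ x.2.2 = 0 := by
  simp [sumB, Submodule.mem_prod]

lemma mem_sumE {x : M × M × M} : x ∈ (sumE : Submodule ℚ (M × M × M)) ↔ x.1 = 0 ∧ x.2.1 = 0 := by
  simp [sumE, Submodule.mem_prod]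

lemma mem_graphAB {f : M →ₗ[ℚ] M} {x : M × M × M} :
    x ∈ graphAB f ↔ x.2.1 = f x.1 ∧ x.2.2 = 0 := by
  obtain ⟨a, b, c⟩ := x
  simp [graphAB, eq_comm]

lemma mem_graphBE {f : M →ₗ[ℚ] M} {x : M × M × M} :
    x ∈ graphBE f ↔ x.1 = 0 ∧ x.2.2 = f x.2.1 := by
  obtain ⟨a, b, c⟩ := x
  simp [graphBE, eq_comm]

lemma mem_graphBA {f : M →ₗ[ℚ] M} {x : M × M × M} :
    x ∈ graphBA f ↔ x.1 = f x.2.1 ∧ x.2.2 = 0 := by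
  obtain ⟨a, b, c⟩ := x
  simp only [graphBA, LinearMap.mem_range, LinearMap.prod_apply, Function.prod_apply,
    LinearMap.id_coe, id_eq, LinearMap.zero_apply, Prod.mk.injEq]
  constructor
  · rintro ⟨y, rfl, rfl, rfl⟩
    simp
  · rintro ⟨rfl, rfl⟩
    exact ⟨b, rfl, rfl, rfl⟩

lemma mem_AB {x : M × M × M} : x ∈ inA (⊤ : Submodule ℚ M) ⊔ sumB ↔ x.2.2 = 0 := by
  simp only [Submodule.mem_sup, mem_inA, mem_sumB]
  constructor
  · rintro ⟨y, ⟨-, -, hy⟩, z, ⟨-, hz⟩, rfl⟩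
    simp [hy, hz]
  · intro h
    exact ⟨(x.1, 0, 0), by simp, (0, x.2.1, 0), by simp, by ext <;> simp [h]⟩

lemma mem_BE {x : M × M × M} : x ∈ (sumB ⊔ sumE : Submodule ℚ (M × M × M)) ↔ x.1 = 0 := by
  simp only [Submodule.mem_sup, mem_sumE, mem_sumB]
  constructor
  · rintro ⟨y, ⟨hy, -⟩, z, ⟨hz, -⟩, rfl⟩
    simp [hy, hz]
  · intro h
    exact ⟨(0, x.2.1, 0), by simp, (0, 0, x.2.2), by simp, by ext <;> simp [h]⟩

lemma mem_AE {x : M × M × M} : x ∈ inA (⊤ : Submodule ℚ M) ⊔ sumE ↔ x.2.1 = 0 := by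
  simp only [Submodule.mem_sup, mem_inA, mem_sumE]
  constructor
  · rintro ⟨y, ⟨-, hy, -⟩, z, ⟨-, hz⟩, rfl⟩
    simp [hy, hz]
  · intro h
    exact ⟨(x.1, 0, 0), by simp, (0, 0, x.2.2), by simp, by ext <;> simp [h]⟩

lemma inA_mono {N N' : Submodule ℚ M} (h : N ≤ N') : inA N ≤ inA N' := fun x hx => by
  rw [mem_inA] at hx ⊢
  exact ⟨h hx.1, hx.2⟩

lemma inA_inf_le {N N' : Submodule ℚ M} : inA N ⊓ inA N' ≤ inA (N ⊓ N') := fun x hx => by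
  simp only [Submodule.mem_inf, mem_inA] at hx ⊢
  exact ⟨⟨hx.1.1, hx.2.1⟩, hx.1.2⟩

lemma graphAB_sup_graphBE_inf (f g : M →ₗ[ℚ] M) {x : M × M × M} :
    x ∈ (graphAB f ⊔ graphBE g) ⊓ (inA ⊤ ⊔ sumE) ↔ x.2.1 = 0 ∧ x.2.2 = -g (f x.1) := by
  rw [Submodule.mem_inf, mem_AE, Submodule.mem_sup, and_comm]
  refine and_congr_right fun h => ?_
  simp only [mem_graphAB, mem_graphBE]
  constructor
  · rintro ⟨y, ⟨hy, hy'⟩, z, ⟨hz, hz'⟩, rfl⟩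
    have hyz : z.2.1 = -f y.1 := by
      rw [← hy]
      exact (neg_eq_of_add_eq_zero_right h).symm
    simp [hy', hz', hyz, hz]
  · intro h'
    exact ⟨(x.1, f x.1, 0), by simp, (0, -f x.1, -g (f x.1)), by simp, by ext <;> simp [h, h']⟩

lemma isGraph_graphAB {f : M →ₗ[ℚ] M} (hf : Function.Injective f) :
    IsGraph ⊥ (inA ⊤) sumB (graphAB f) where
  le_sup x hx := mem_AB.2 (mem_graphAB.1 hx).2
  dom x hx := by
    rw [mem_inA] at hx
    exact Submodule.mem_sup.2 ⟨(0, -f x.1, 0), by simp [mem_sumB], (x.1, f x.1, 0),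
      by simp [mem_graphAB], by ext <;> simp [hx]⟩
  inj x hx := by
    simp only [Submodule.mem_inf, mem_graphAB, mem_inA] at hx
    have h : x.1 = 0 := hf (by rw [map_zero, ← hx.1.1, hx.2.2.1])
    simp [Prod.ext_iff, h, hx.2.2]

lemma isGraph_graphBA_id : IsGraph ⊥ sumB (inA ⊤) (graphAB (LinearMap.id : M →ₗ[ℚ] M)) where
  le_sup x hx := by
    rw [sup_comm]
    exact mem_AB.2 (mem_graphAB.1 hx).2
  dom x hx := by
    rw [mem_sumB] at hx
    exact Submodule.mem_sup.2 ⟨(-x.2.1, 0, 0), by simp [mem_inA], (x.2.1, x.2.1, 0),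
      by simp [mem_graphAB], by ext <;> simp [hx]⟩
  inj x hx := by
    simp only [Submodule.mem_inf, mem_graphAB, mem_sumB, LinearMap.id_apply] at hx
    simp [Prod.ext_iff, hx]

lemma isGraph_graphBE_id : IsGraph ⊥ sumB sumE (graphBE (LinearMap.id : M →ₗ[ℚ] M)) where
  le_sup x hx := mem_BE.2 (mem_graphBE.1 hx).1
  dom x hx := by
    rw [mem_sumB] at hx
    exact Submodule.mem_sup.2 ⟨(0, 0, -x.2.1), by simp [mem_sumE], (0, x.2.1, x.2.1),
      by simp [mem_graphBE], by ext <;> simp [hx]⟩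
  inj x hx := by
    simp only [Submodule.mem_inf, mem_graphBE, mem_sumB, LinearMap.id_apply] at hx
    exact Prod.ext hx.1.1 (Prod.ext (hx.1.2.symm.trans hx.2.2) hx.2.2)

lemma isGraph_graphEB_id : IsGraph ⊥ sumE sumB (graphBE (LinearMap.id : M →ₗ[ℚ] M)) where
  le_sup x hx := by
    rw [sup_comm]
    exact mem_BE.2 (mem_graphBE.1 hx).1
  dom x hx := by
    rw [mem_sumE] at hx
    exact Submodule.mem_sup.2 ⟨(0, -x.2.2, 0), by simp [mem_sumB], (0, x.2.2, x.2.2),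
      by simp [mem_graphBE], by ext <;> simp [hx]⟩
  inj x hx := by
    simp only [Submodule.mem_inf, mem_graphBE, mem_sumE, LinearMap.id_apply] at hx
    simp [Prod.ext_iff, hx]

lemma relImage_graphAB (f : M →ₗ[ℚ] M) (N : Submodule ℚ M) :
    relImage (graphAB LinearMap.id) (inA ⊤) (relImage (graphAB f) sumB (inA N)) =
      inA (N.map f) := by
  ext x
  simp only [relImage, Submodule.mem_inf, Submodule.mem_sup, mem_inA, mem_graphAB, mem_sumB,
    LinearMap.id_apply, Submodule.mem_map, Submodule.mem_top, true_and]
  constructor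
  · rintro ⟨⟨-, ⟨⟨a, ⟨ha, ha', ha''⟩, b, ⟨hb, hb'⟩, rfl⟩, hab, -⟩, d, ⟨hd, hd'⟩, rfl⟩, h⟩
    refine ⟨⟨a.1, ha, ?_⟩, h⟩
    simp only [Prod.fst_add, Prod.snd_add] at hab h ⊢
    rw [hab, zero_add, ← hd, ← neg_eq_of_add_eq_zero_right h.1, ha', hb, zero_add,
      ← neg_eq_of_add_eq_zero_right hab, map_neg, neg_neg]
  · rintro ⟨⟨a, ha, hx⟩, h⟩
    refine ⟨⟨(0, -f a, 0), ⟨⟨(a, 0, 0), by simpa using ha, (-a, -f a, 0), by simp, by simp⟩,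
      by simp⟩, (f a, f a, 0), by simp, ?_⟩, h⟩
    ext <;> simp [hx, h]

variable {ι K G : Type}

/-- The interpretation of the names by submodules of `M × M × M`. -/
def interp (p : K → G → M →ₗ[ℚ] M) (q : M →ₗ[ℚ] M) (O : Submodule ℚ M) (N : ι → Submodule ℚ M) :
    Name ι K G → Submodule ℚ (M × M × M)
  | .bot => ⊥
  | .objA => inA ⊤
  | .objB => sumB
  | .objE => sumE
  | .idAB => graphAB LinearMap.id
  | .idBE => graphBE LinearMap.id
  | .fold => graphBA q
  | .origin => inA O
  | .stepAB k g => graphAB (p k g)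
  | .stepBE k g => graphBE (p k g)
  | .pred P => inA (N P)

/-- Validity of a clause for predicates interpreted by submodules of `M`. -/
def Clause.HoldsIn (p : K → G → M →ₗ[ℚ] M) (O : Submodule ℚ M) (N : ι → Submodule ℚ M) :
    Clause ι K G → Prop
  | .base P => O ≤ N P
  | .meet P P' Q => N P ⊓ N P' ≤ N Q
  | .push k g P Q => (N P).map (p k g) ≤ N Q
  | .pop k g P Q => N P ⊓ Submodule.map (p k g) ⊤ ≤ (N Q).map (p k g)

lemma isModel_interp {p : K → G → M →ₗ[ℚ] M} {q : M →ₗ[ℚ] M} {O : Submodule ℚ M}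
    {N : ι → Submodule ℚ M} {C : Set (Clause ι K G)} {bad : ι}
    (hp : ∀ k g, Function.Injective (p k g))
    (hcomm : ∀ k g l h, k ≠ l → ∀ a, p k g (p l h a) = p l h (p k g a))
    (hq : Function.Injective q) (hqO : ∀ a, q a ∈ O)
    (hC : ∀ c ∈ C, c.HoldsIn p O N) (hbad : N bad = ⊥) :
    IsModel C bad (interp p q O N) where
  bot_le x := bot_le
  le_top x := by
    refine le_top.trans fun x _ => Submodule.mem_sup.2
      ⟨(x.1, x.2.1, 0), mem_AB.2 rfl, (0, 0, x.2.2), by simp [interp, mem_sumE], by simp⟩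
  pred_le P := inA_mono le_top
  origin_le := inA_mono le_top
  indep x hx := mem_sumB.2 ⟨mem_BE.1 hx.2, mem_AB.1 hx.1⟩
  graph_AB := isGraph_graphAB Function.injective_id
  graph_BA := isGraph_graphBA_id
  graph_BE := isGraph_graphBE_id
  graph_EB := isGraph_graphEB_id
  graph_step k g := isGraph_graphAB (hp k g)
  stepBE_le k g x hx := mem_BE.2 (mem_graphBE.1 hx).1
  step_eq k g := by
    ext x
    simp only [interp, graphAB_sup_graphBE_inf, LinearMap.id_apply]
  step_comm k g l h hkl := by
    ext x
    simp only [interp, graphAB_sup_graphBE_inf, hcomm k g l h hkl]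
  fold_dom x hx := by
    have hx := mem_sumB.1 hx
    exact Submodule.mem_sup.2 ⟨(-q x.2.1, 0, 0), mem_inA.2 ⟨neg_mem (hqO _), rfl, rfl⟩,
      (q x.2.1, x.2.1, 0), mem_graphBA.2 ⟨rfl, rfl⟩, by ext <;> simp [hx]⟩
  fold_inj x hx := by
    have h₁ := mem_graphBA.1 hx.1
    have h₂ := mem_sumB.1 hx.2
    have h : x.2.1 = 0 := hq (by rw [map_zero, ← h₁.1, h₂.1])
    simp [interp, Prod.ext_iff, h, h₂]
  holds c hc := by
    have := hC c hc
    cases c with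
    | base P => exact inA_mono this
    | meet P P' Q => exact inA_inf_le.trans (inA_mono this)
    | push k g P Q =>
      simp only [Clause.Holds, shift, interp, relImage_graphAB]
      exact inA_mono this
    | pop k g P Q =>
      simp only [Clause.Holds, shift, interp, relImage_graphAB]
      exact inA_inf_le.trans (inA_mono this)
  bad_le := by simp [interp, hbad, inA]

end Submodules

section Completeness

variable {ι K G : Type} [DecidableEq K]

/-- If `bad` is not derivable for any stacks, then there is a nontrivial model. -/
lemma exists_model [Countable (K → List G)] {C : Set (Clause ι K G)} {P₀ bad : ι}
    {y₀ : K → List G} (h : ∀ y, ¬ Derives C P₀ y₀ bad y) :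
    ∃ (L : Type) (_ : Lattice L) (_ : IsModularLattice L) (w : Name ι K G → L),
      IsModel C bad w ∧ w .bot ≠ w .objA ∧ ∀ x, Represents w y₀ x → x ≤ w (.pred P₀) := by
  let push (k : K) (g : G) : (K → List G) × ℕ → (K → List G) × ℕ := Prod.map (pushStack k g) id
  have hpush (k g) : Function.Injective (push k g) :=
    (pushStack_injective k g).prodMap Function.injective_id
  obtain ⟨e, he⟩ := exists_injective_nat ((K → List G) × ℕ)
  let fold : (K → List G) × ℕ → (K → List G) × ℕ := fun x => (fun _ => [], e x)
  have hfold : Function.Injective fold := fun x y h => he (Prod.ext_iff.1 h).2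
  let S (s : Set (K → List G)) : Submodule ℚ (((K → List G) × ℕ) →₀ ℚ) :=
    Finsupp.supported ℚ ℚ (Prod.fst ⁻¹' s)
  let p (k : K) (g : G) := Finsupp.lmapDomain ℚ ℚ (push k g)
  have hS (s k g) : (S s).map (p k g) = S (pushStack k g '' s) := by
    simp only [S, p, Finsupp.lmapDomain_supported]
    congr 1
    ext ⟨y, n⟩
    simp [push]
  have htop : S Set.univ = ⊤ := by simp [S]
  let O : Submodule ℚ (((K → List G) × ℕ) →₀ ℚ) := S {fun _ => []}
  let N (P : ι) := S {y | Derives C P₀ y₀ P y}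
  let q := Finsupp.lmapDomain ℚ ℚ fold
  have hmono {s t : Set (K → List G)} (hst : s ⊆ t) : S s ≤ S t :=
    Finsupp.supported_mono (Set.preimage_mono hst)
  have key : IsModel C bad (interp p q O N) := by
    refine isModel_interp (fun k g => Finsupp.mapDomain_injective (hpush k g)) ?_
      (Finsupp.mapDomain_injective hfold) ?_ ?_ ?_
    · intro k g l h hkl a
      simp only [p, Finsupp.lmapDomain_apply, ← Finsupp.mapDomain_comp]
      congr 1
      funext x
      exact Prod.ext (pushStack_comm hkl _ _ _) rfl
    · intro a
      classical
      simp only [O, S, q, Finsupp.lmapDomain_apply, Finsupp.mem_supported]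
      refine (Finset.coe_subset.2 Finsupp.mapDomain_support).trans fun x hx => ?_
      obtain ⟨z, -, rfl⟩ := Finset.mem_image.1 (Finset.mem_coe.1 hx)
      rfl
    · intro c hc
      cases c with
      | base P =>
        refine hmono ?_
        rintro y rfl
        exact .base hc
      | meet P P' Q =>
        simp only [Clause.HoldsIn, N, S, ← Finsupp.supported_inter, ← Set.preimage_inter]
        exact hmono fun y hy => .meet hc hy.1 hy.2
      | push k g P Q =>
        simp only [Clause.HoldsIn, N, hS]
        refine hmono ?_
        rintro _ ⟨y, hy, rfl⟩
        exact .push hc hy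
      | pop k g P Q =>
        simp only [Clause.HoldsIn, N, hS, ← htop]
        simp only [S, ← Finsupp.supported_inter, ← Set.preimage_inter]
        refine hmono ?_
        rintro _ ⟨hy, y, -, rfl⟩
        exact ⟨y, .pop hc hy, rfl⟩
    · simp [N, S, h]
  refine ⟨_, _, inferInstance, _, key, fun h₀ => ?_, ?_⟩
  · have hm : ((Finsupp.single (y₀, 0) 1, 0, 0) : (((K → List G) × ℕ) →₀ ℚ) × _ × _) ∈
        interp p q O N .objA := mem_inA.2 ⟨Submodule.mem_top, rfl, rfl⟩
    rw [← h₀] at hm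
    simp [interp] at hm
  · have hrep {y x} (hx : Represents (interp p q O N) y x) : x = inA (S {y}) := by
      induction hx with
      | origin => rfl
      | push k g _ ih =>
        rw [ih]
        exact (relImage_graphAB _ _).trans (by rw [hS, Set.image_singleton])
    intro x hx
    rw [hrep hx]
    exact inA_mono (hmono (by simpa using Derives.start))

end Completeness

section Equations

variable {ι K G : Type}

/-- The equation expressing `s ≤ t`. -/
def leEq (s t : LatTerm) : LatTerm × LatTerm := (s.inf t, s)

/-- The term describing `shift`, in the variables `a`, `b`, `i`, `d` for `objA`, `objB`, `idAB` and
the step. -/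
def shiftTerm (a b i d : ℕ) (t : LatTerm) : LatTerm :=
  .inf (.sup (.inf (.sup t (.var d)) (.var b)) (.var i)) (.var a)

/-- The term representing a single stack, in variables as in `shiftTerm` and with `o` for
`origin`. -/
def stackTerm (a b i o : ℕ) (d : G → ℕ) (l : List G) : LatTerm :=
  l.foldr (fun g => shiftTerm a b i (d g)) (.var o)

/-- The equations expressing `IsGraph z A B r`. -/
def graphEqs (z A B r : LatTerm) : Set (LatTerm × LatTerm) :=
  {leEq r (.sup A B), leEq A (.sup B r), leEq (.inf r A) z}

/-- The equation expressing the validity of a clause. -/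
def Clause.toEq (num : Name ι K G → ℕ) : Clause ι K G → LatTerm × LatTerm
  | .base P => leEq (.var (num .origin)) (.var (num (.pred P)))
  | .meet P P' Q =>
    leEq (.inf (.var (num (.pred P))) (.var (num (.pred P')))) (.var (num (.pred Q)))
  | .push k g P Q =>
    leEq (shiftTerm (num .objA) (num .objB) (num .idAB) (num (.stepAB k g)) (.var (num (.pred P))))
      (.var (num (.pred Q)))
  | .pop k g P Q =>
    leEq (.inf (.var (num (.pred P)))
        (shiftTerm (num .objA) (num .objB) (num .idAB) (num (.stepAB k g)) (.var (num .objA))))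
      (shiftTerm (num .objA) (num .objB) (num .idAB) (num (.stepAB k g)) (.var (num (.pred Q))))

/-- The equations expressing `IsModel`, where the name `x` is represented by the variable
`num x`. -/
def modelEqs (num : Name ι K G → ℕ) (C : Set (Clause ι K G)) (bad : ι) :
    Set (LatTerm × LatTerm) :=
  let t (x : Name ι K G) : LatTerm := .var (num x)
  let A := t .objA
  let B := t .objB
  let E := t .objE
  Set.range (fun x => leEq (t .bot) (t x)) ∪
  Set.range (fun x => leEq (t x) (.sup (.sup A B) E)) ∪
  Set.range (fun P => leEq (t (.pred P)) A) ∪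
  {leEq (t .origin) A, leEq (.inf (.sup A B) (.sup B E)) B, leEq B (.sup (t .origin) (t .fold)),
    leEq (.inf (t .fold) B) (t .bot), leEq (t (.pred bad)) (t .bot)} ∪
  graphEqs (t .bot) A B (t .idAB) ∪ graphEqs (t .bot) B A (t .idAB) ∪
  graphEqs (t .bot) B E (t .idBE) ∪ graphEqs (t .bot) E B (t .idBE) ∪
  (⋃ x : K × G, graphEqs (t .bot) A B (t (.stepAB x.1 x.2))) ∪
  Set.range (fun x : K × G => leEq (t (.stepBE x.1 x.2)) (.sup B E)) ∪
  Set.range (fun x : K × G =>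
    (.inf (.sup (t .idAB) (t (.stepBE x.1 x.2))) (.sup A E),
      .inf (.sup (t (.stepAB x.1 x.2)) (t .idBE)) (.sup A E))) ∪
  (fun x : (K × G) × K × G =>
    (.inf (.sup (t (.stepAB x.1.1 x.1.2)) (t (.stepBE x.2.1 x.2.2))) (.sup A E),
      .inf (.sup (t (.stepAB x.2.1 x.2.2)) (t (.stepBE x.1.1 x.1.2))) (.sup A E))) ''
    {x | x.1.1 ≠ x.2.1} ∪
  Clause.toEq num '' C

lemma eval_leEq {L : Type*} [Lattice L] {v : ℕ → L} {s t : LatTerm} :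
    (leEq s t).1.eval v = (leEq s t).2.eval v ↔ s.eval v ≤ t.eval v :=
  inf_eq_left

lemma sat_graphEqs {L : Type*} [Lattice L] {v : ℕ → L} {z A B r : LatTerm} :
    (∀ p ∈ graphEqs z A B r, p.1.eval v = p.2.eval v) ↔
      IsGraph (z.eval v) (A.eval v) (B.eval v) (r.eval v) := by
  simp only [graphEqs, Set.mem_insert_iff, Set.mem_singleton_iff, forall_eq_or_imp, forall_eq,
    eval_leEq]
  exact ⟨fun h => ⟨h.1, h.2.1, h.2.2⟩, fun h => ⟨h.1, h.2, h.3⟩⟩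

lemma Clause.eval_toEq {L : Type*} [Lattice L] {v : ℕ → L} {num : Name ι K G → ℕ}
    (c : Clause ι K G) :
    (c.toEq num).1.eval v = (c.toEq num).2.eval v ↔ c.Holds (fun x => v (num x)) := by
  cases c <;> exact eval_leEq

lemma sat_modelEqs {L : Type*} [Lattice L] {v : ℕ → L} {num : Name ι K G → ℕ}
    {C : Set (Clause ι K G)} {bad : ι} :
    (∀ p ∈ modelEqs num C bad, p.1.eval v = p.2.eval v) ↔
      IsModel C bad (fun x => v (num x)) := by
  simp only [modelEqs, Set.mem_union, or_imp, forall_and, Set.mem_iUnion, forall_exists_index,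
    Set.forall_mem_range, Set.forall_mem_image, sat_graphEqs, Set.mem_insert_iff,
    Set.mem_singleton_iff, forall_eq, eval_leEq, Clause.eval_toEq, LatTerm.eval,
    Set.mem_ofPred_eq]
  constructor
  · rintro ⟨⟨⟨⟨⟨⟨⟨⟨⟨⟨⟨⟨hbot, htop⟩, hpred⟩, horigin, hindep, hdom, hinj, hbad⟩, hAB⟩, hBA⟩, hBE⟩,
      hEB⟩, hstep⟩, hstepBE⟩, heq⟩, hcomm⟩, hclause⟩
    exact ⟨hbot, htop, hpred, horigin, hindep, hAB, hBA, hBE, hEB,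
      fun k g => sat_graphEqs.1 fun p hp => hstep p (k, g) hp, fun k g => hstepBE (k, g),
      fun k g => heq (k, g), fun k g l h hkl => hcomm (x := ((k, g), l, h)) hkl, hdom, hinj,
      fun c hc => hclause hc, hbad⟩
  · intro h
    have hstep (x : K × G) : ∀ p ∈ graphEqs (.var (num .bot)) (.var (num .objA))
        (.var (num .objB)) (.var (num (.stepAB x.1 x.2))), p.1.eval v = p.2.eval v :=
      sat_graphEqs.2 (h.graph_step x.1 x.2)
    exact ⟨⟨⟨⟨⟨⟨⟨⟨⟨⟨⟨⟨h.bot_le, h.le_top⟩, h.pred_le⟩, h.origin_le, h.indep, h.fold_dom, h.fold_inj,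
      h.bad_le⟩, h.graph_AB⟩, h.graph_BA⟩, h.graph_BE⟩, h.graph_EB⟩, fun p x => hstep x p⟩,
      fun x => h.stepBE_le _ _⟩, fun x => h.step_eq _ _⟩, fun x hx => h.step_comm _ _ _ _ hx⟩,
      fun c hc => h.holds c hc⟩

lemma mem_vars_conj {Φ : LatConj} {i : ℕ} :
    i ∈ Φ.vars ↔ ∃ p ∈ Φ, i ∈ p.1.vars ∨ i ∈ p.2.vars := by
  induction Φ with
  | nil => simp [LatConj.vars]
  | cons p Φ ih =>
    rw [List.exists_mem_cons_iff, ← ih, ← Finset.mem_union, ← Finset.mem_union]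
    rfl

lemma vars_var_subset {s : Set ℕ} {i : ℕ} : ↑(LatTerm.var i).vars ⊆ s ↔ i ∈ s := by
  simp [LatTerm.vars]

lemma vars_sup_subset {s : Set ℕ} {t u : LatTerm} :
    ↑(t.sup u).vars ⊆ s ↔ (t.vars : Set ℕ) ⊆ s ∧ (u.vars : Set ℕ) ⊆ s := by
  rw [LatTerm.vars, Finset.coe_union, Set.union_subset_iff]

lemma vars_inf_subset {s : Set ℕ} {t u : LatTerm} :
    ↑(t.inf u).vars ⊆ s ↔ (t.vars : Set ℕ) ⊆ s ∧ (u.vars : Set ℕ) ⊆ s := by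
  rw [LatTerm.vars, Finset.coe_union, Set.union_subset_iff]

lemma vars_stackTerm_subset {s : Set ℕ} {a b i o : ℕ} {d : G → ℕ} (ha : a ∈ s) (hb : b ∈ s)
    (hi : i ∈ s) (ho : o ∈ s) (hd : ∀ g, d g ∈ s) (l : List G) :
    ↑(stackTerm a b i o d l).vars ⊆ s := by
  induction l with
  | nil => simpa [stackTerm, LatTerm.vars]
  | cons g l ih =>
    rw [stackTerm, List.foldr_cons, shiftTerm]
    simpa only [vars_var_subset, vars_sup_subset, vars_inf_subset, ha, hb, hi, hd, and_true]

lemma vars_modelEqs_subset {num : Name ι K G → ℕ} {C : Set (Clause ι K G)} {bad : ι} :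
    ∀ p ∈ modelEqs num C bad,
      (p.1.vars : Set ℕ) ⊆ Set.range num ∧ (p.2.vars : Set ℕ) ⊆ Set.range num := by
  intro p hp
  simp only [modelEqs, graphEqs, Set.mem_union, Set.mem_iUnion, Set.mem_range, Set.mem_image,
    Set.mem_insert_iff, Set.mem_singleton_iff] at hp
  have hclause (c : Clause ι K G) : ((c.toEq num).1.vars : Set ℕ) ⊆ Set.range num ∧
      ((c.toEq num).2.vars : Set ℕ) ⊆ Set.range num := by
    cases c <;> simp only [Clause.toEq, leEq, shiftTerm, vars_var_subset, vars_sup_subset,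
      vars_inf_subset, Set.mem_range_self, and_true]
  casesm* _ ∨ _, ∃ _, _, _ ∧ _ <;> subst p <;> first
    | simp only [leEq, vars_var_subset, vars_sup_subset, vars_inf_subset, Set.mem_range_self,
      and_true]
    | exact hclause _

lemma finite_modelEqs [Finite ι] [Finite K] [Finite G] (num : Name ι K G → ℕ)
    (C : Set (Clause ι K G)) (bad : ι) : (modelEqs num C bad).Finite := by
  have := Fintype.ofFinite ι
  have := Fintype.ofFinite K
  have := Fintype.ofFinite G
  have hgraph (z A B r : LatTerm) : (graphEqs z A B r).Finite := by
    simp [graphEqs]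
  have hC := C.toFinite
  simp only [modelEqs, Set.finite_union, hgraph, hC.image, Set.toFinite,
    Set.finite_iUnion, implies_true, and_true]


lemma eval_stackTerm {L : Type*} [Lattice L] [DecidableEq K] (v : ℕ → L) (num : Name ι K G → ℕ)
    (k : K) (l : List G) :
    Represents (fun x => v (num x)) (update (fun _ => []) k l)
      ((stackTerm (num .objA) (num .objB) (num .idAB) (num .origin)
        (fun g => num (.stepAB k g)) l).eval v) := by
  induction l with
  | nil =>
    rw [update_eq_self_iff.2 rfl]
    exact .origin
  | cons g l ih =>
    have := ih.push k g
    rw [pushStack, update_idem, update_self] at this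
    exact this

/-- Derivability can be expressed by consistency of conjunctions of lattice equations, only one of
which depends on the initial stack. -/
theorem exists_conj_consistent_iff [Finite ι] [Finite K] [Finite G] [DecidableEq K]
    (C : Set (Clause ι K G)) (P₀ bad : ι) (k : K) :
    ∃ (a b i o p : ℕ) (d : G → ℕ) (Ψ : LatConj), ∀ l : List G,
      (∃ (L : Type) (_ : Lattice L) (_ : IsModularLattice L) (v : ℕ → L),
        LatConj.Sat (leEq (stackTerm a b i o d l) (.var p) :: Ψ) v ∧
        LatConj.Nontriv (leEq (stackTerm a b i o d l) (.var p) :: Ψ) v) ↔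
      ∀ y, ¬ Derives C P₀ (update (fun _ => []) k l) bad y := by
  have := Fintype.ofFinite ι
  have := Fintype.ofFinite K
  have := Fintype.ofFinite G
  obtain ⟨num, hnum⟩ := exists_injective_nat (Name ι K G)
  have hfin := finite_modelEqs num C bad
  refine ⟨num .objA, num .objB, num .idAB, num .origin, num (.pred P₀),
    fun g => num (.stepAB k g), hfin.toFinset.toList, fun l => ?_⟩
  have hrepr {L : Type} [Lattice L] (v : ℕ → L) := eval_stackTerm v num k l
  have hvars := vars_stackTerm_subset (Set.mem_range_self (f := num) .objA)
    (Set.mem_range_self .objB) (Set.mem_range_self .idAB) (Set.mem_range_self .origin)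
    (fun g => Set.mem_range_self (.stepAB k g)) l
  set T := stackTerm (num .objA) (num .objB) (num .idAB) (num .origin)
    (fun g => num (.stepAB k g)) l
  refine ⟨?_, fun h => ?_⟩
  · rintro ⟨L, _, _, v, hsat, i, hi, j, hj, hij⟩ y hy
    have hsat' := List.forall_mem_cons.1 hsat
    have H : IsModel C bad (fun x => v (num x)) :=
      sat_modelEqs.1 fun p hp => hsat'.2 p (by simpa using hp)
    have hbot := H.eq_bot_of_derives (hrepr v) (eval_leEq.1 hsat'.1) hy
    have hrange {i : ℕ} (hi : i ∈ LatConj.vars (leEq T (.var (num (.pred P₀))) ::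
        hfin.toFinset.toList)) : i ∈ Set.range num := by
      obtain ⟨p, hp, hip⟩ := mem_vars_conj.1 hi
      have hp' : (p.1.vars : Set ℕ) ⊆ Set.range num ∧ (p.2.vars : Set ℕ) ⊆ Set.range num := by
        rcases List.mem_cons.1 hp with rfl | hp
        · exact ⟨vars_inf_subset.2 ⟨hvars, vars_var_subset.2 (Set.mem_range_self _)⟩, hvars⟩
        · exact vars_modelEqs_subset p (by simpa using hp)
      exact hip.elim (fun h => hp'.1 h) (fun h => hp'.2 h)
    obtain ⟨x, rfl⟩ := hrange hi
    obtain ⟨x', rfl⟩ := hrange hj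
    exact hij ((hbot x).trans (hbot x').symm)
  · obtain ⟨L, hL, hmod, w, H, hne, hrep⟩ := exists_model h
    have hv : (fun x => extend num w (fun _ => w .bot) (num x)) = w :=
      funext fun x => hnum.extend_apply w _ x
    have hbot_le : leEq (.var (num .bot)) (.var (num .objA)) ∈
        leEq T (.var (num (.pred P₀))) :: hfin.toFinset.toList := by
      simp [modelEqs]
    refine ⟨L, hL, hmod, extend num w (fun _ => w .bot), ?_, num .bot, ?_, num .objA, ?_, ?_⟩
    · refine List.forall_mem_cons.2 ⟨eval_leEq.2 ?_, fun p hp => ?_⟩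
      · rw [LatTerm.eval, hnum.extend_apply]
        have := hrepr (extend num w (fun _ => w .bot))
        rw [hv] at this
        exact hrep _ this
      · exact sat_modelEqs.2 (hv.symm ▸ H) p (by simpa using hp)
    · exact mem_vars_conj.2 ⟨_, hbot_le, by simp [leEq, LatTerm.vars]⟩
    · exact mem_vars_conj.2 ⟨_, hbot_le, by simp [leEq, LatTerm.vars]⟩
    · rwa [hnum.extend_apply, hnum.extend_apply]

end Equations

section Machine

open Turing TM2 StateTransition

variable {K G Λ σ : Type}

/-- The predicates used to describe the behaviour of a stack machine with statements in `T`. -/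
inductive MachinePred (K G T σ : Type) : Type
  /-- The machine executes the statement `q` in the internal state `s`. -/
  | stmt (q : T) (s : σ)
  /-- There is no condition on the stacks. -/
  | all
  /-- The stack `k` has top element `g`. -/
  | top (k : K) (g : G)
  /-- The stack `k` is empty. -/
  | empty (k : K)
  /-- The machine halts. -/
  | halted
deriving Fintype

/-- The clauses describing the behaviour of the stack machine `M`. -/
inductive MachineClause (M : Λ → Stmt (fun _ : K => G) Λ σ) (T : Set (Stmt (fun _ : K => G) Λ σ)) :
    Clause (MachinePred K G T σ) K G → Prop
  | all_base : MachineClause M T (.base .all)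
  | all_push (k g) : MachineClause M T (.push k g .all .all)
  | top (k g) : MachineClause M T (.push k g .all (.top k g))
  | empty_base (k) : MachineClause M T (.base (.empty k))
  | empty_push {k k'} (g) : k' ≠ k → MachineClause M T (.push k' g (.empty k) (.empty k))
  | push {q q' : T} {k f} (s) : q.1 = .push k f q'.1 →
      MachineClause M T (.push k (f s) (.stmt q s) (.stmt q' s))
  | peek_top {q q' : T} {k f} (s g) : q.1 = .peek k f q'.1 →
      MachineClause M T (.meet (.stmt q s) (.top k g) (.stmt q' (f s (some g))))
  | peek_empty {q q' : T} {k f} (s) : q.1 = .peek k f q'.1 →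
      MachineClause M T (.meet (.stmt q s) (.empty k) (.stmt q' (f s none)))
  | pop_top {q q' : T} {k f} (s g) : q.1 = .pop k f q'.1 →
      MachineClause M T (.pop k g (.stmt q s) (.stmt q' (f s (some g))))
  | pop_empty {q q' : T} {k f} (s) : q.1 = .pop k f q'.1 →
      MachineClause M T (.meet (.stmt q s) (.empty k) (.stmt q' (f s none)))
  | load {q q' : T} {a} (s) : q.1 = .load a q'.1 →
      MachineClause M T (.meet (.stmt q s) (.stmt q s) (.stmt q' (a s)))
  | branch_true {q q' : T} {p q''} (s) : q.1 = .branch p q'.1 q'' → p s = true →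
      MachineClause M T (.meet (.stmt q s) (.stmt q s) (.stmt q' s))
  | branch_false {q q' : T} {p q''} (s) : q.1 = .branch p q'' q'.1 → p s = false →
      MachineClause M T (.meet (.stmt q s) (.stmt q s) (.stmt q' s))
  | goto {q q' : T} {l} (s) : q.1 = .goto l → q'.1 = M (l s) →
      MachineClause M T (.meet (.stmt q s) (.stmt q s) (.stmt q' s))
  | halt {q : T} (s) : q.1 = .halt → MachineClause M T (.meet (.stmt q s) (.stmt q s) .halted)

variable [DecidableEq K] {M : Λ → Stmt (fun _ : K => G) Λ σ}
  {T : Set (Stmt (fun _ : K => G) Λ σ)}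
  {P₀ : MachinePred K G T σ} {y₀ : K → List G}

/-- The intended meaning of the predicates for computations starting with `c₀`. -/
def MachinePred.Valid (M : Λ → Stmt (fun _ : K => G) Λ σ) (c₀ : Cfg (fun _ : K => G) Λ σ) :
    MachinePred K G T σ → (K → List G) → Prop
  | .stmt q s, y => StateTransition.Reaches (step M) c₀ (stepAux q.1 s y)
  | .all, _ => True
  | .top k g, y => ∃ l, y k = g :: l
  | .empty k, y => y k = []
  | .halted, _ => (eval (step M) c₀).Dom

lemma valid_of_derives {c₀ : Cfg (fun _ : K => G) Λ σ} (h₀ : P₀.Valid M c₀ y₀)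
    {P : MachinePred K G T σ} {y : K → List G} (h : Derives {c | MachineClause M T c} P₀ y₀ P y) :
    P.Valid M c₀ y := by
  induction h with
  | start => exact h₀
  | base h => cases h <;> trivial
  | push h _ ih =>
    cases h with
    | all_push => trivial
    | top k g => exact ⟨_, update_self _ _ _⟩
    | empty_push g hk => exact (update_of_ne hk.symm _ _).trans ih
    | push s hq =>
      rw [MachinePred.Valid, hq] at ih
      exact ih
  | @pop k g P Q y h _ ih =>
    cases h with
    | pop_top s g hq =>
      rw [MachinePred.Valid, hq] at ih
      simpa [MachinePred.Valid, pushStack] using ih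
  | meet h _ _ ih ih' =>
    cases h with
    | peek_top s g hq =>
      obtain ⟨l, hl⟩ := ih'
      rw [MachinePred.Valid, hq, stepAux, hl] at ih
      exact ih
    | peek_empty s hq =>
      rw [MachinePred.Valid, hq, stepAux, (ih' : _ = _)] at ih
      exact ih
    | pop_empty s hq =>
      rw [MachinePred.Valid, hq, stepAux, update_eq_self_iff.2 (by rw [(ih' : _ = _)]; rfl),
        (ih' : _ = _)] at ih
      exact ih
    | load s hq =>
      rw [MachinePred.Valid, hq] at ih
      exact ih
    | branch_true s hq hs =>
      rw [MachinePred.Valid, hq, stepAux, hs] at ih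
      exact ih
    | branch_false s hq hs =>
      rw [MachinePred.Valid, hq, stepAux, hs] at ih
      exact ih
    | goto s hq hq' =>
      rw [MachinePred.Valid, hq] at ih
      rw [MachinePred.Valid, hq']
      exact ih.tail rfl
    | halt s hq =>
      rw [MachinePred.Valid, hq] at ih
      exact Part.dom_iff_mem.2 ⟨_, mem_eval.2 ⟨ih, rfl⟩⟩

lemma pushStack_induction [Finite K] {Q : (K → List G) → Prop} {s : Set K}
    (hbase : Q fun _ => []) (hpush : ∀ k ∈ s, ∀ g y, Q y → Q (pushStack k g y))
    (y : K → List G) (hy : ∀ k ∉ s, y k = []) : Q y := by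
  induction s, s.toFinite using Set.Finite.induction_on generalizing y with
  | empty => rwa [funext fun k => hy k (by simp)]
  | @insert k s _ _ ih =>
    have h : Q (update y k []) := by
      refine ih (fun l hl => hpush l (.inr hl)) _ fun l hl => ?_
      by_cases e : l = k
      · rw [e, update_self]
      · rw [update_of_ne e]
        exact hy l (by simp [e, hl])
    rw [← update_eq_self k y]
    induction y k with
    | nil => exact h
    | cons g l hl => simpa [pushStack] using hpush k (.inl rfl) g _ hl

lemma derives_all [Finite K] (y : K → List G) :
    Derives {c | MachineClause M T c} P₀ y₀ .all y :=
  pushStack_induction (s := Set.univ) (.base .all_base)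
    (fun k _ g _ h => .push (.all_push k g) h) y (by simp)

lemma derives_top [Finite K] {y : K → List G} {k : K} {g : G} {l : List G} (h : y k = g :: l) :
    Derives {c | MachineClause M T c} P₀ y₀ (.top k g) y := by
  rw [← pushStack_update h]
  exact .push (.top k g) (derives_all _)

lemma derives_empty [Finite K] {y : K → List G} {k : K} (h : y k = []) :
    Derives {c | MachineClause M T c} P₀ y₀ (.empty k) y :=
  pushStack_induction (s := {k}ᶜ) (.base (.empty_base k))
    (fun k' hk g _ h => .push (.empty_push g hk) h) y (by simpa)

/-- The predicate corresponding to the current configuration is derivable. -/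
def DerivesCfg (M : Λ → Stmt (fun _ : K => G) Λ σ) (P₀ : MachinePred K G T σ) (y₀ : K → List G) :
    Cfg (fun _ : K => G) Λ σ → Prop
  | ⟨some l, s, y⟩ => ∃ h : M l ∈ T, Derives {c | MachineClause M T c} P₀ y₀ (.stmt ⟨M l, h⟩ s) y
  | ⟨none, _, y⟩ => Derives {c | MachineClause M T c} P₀ y₀ .halted y

lemma derivesCfg_stepAux [Finite K] (hT : ∀ q ∈ T, ↑(stmts₁ q) ⊆ T)
    (hgoto : ∀ l, .goto l ∈ T → ∀ s, M (l s) ∈ T) {q : Stmt (fun _ : K => G) Λ σ} (hq : q ∈ T)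
    {s : σ} {y : K → List G} (h : Derives {c | MachineClause M T c} P₀ y₀ (.stmt ⟨q, hq⟩ s) y) :
    DerivesCfg M P₀ y₀ (stepAux q s y) := by
  induction q generalizing s y with
  | push k f q ih =>
    exact ih (hT _ hq (by simp [stmts₁, stmts₁_self])) (.push (.push s rfl) h)
  | peek k f q ih =>
    have hq' : q ∈ T := hT _ hq (by simp [stmts₁, stmts₁_self])
    rw [stepAux]
    cases e : y k with
    | nil => exact ih hq' (.meet (.peek_empty s rfl) h (derives_empty e))
    | cons g l => exact ih hq' (.meet (.peek_top s g rfl) h (derives_top e))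
  | pop k f q ih =>
    have hq' : q ∈ T := hT _ hq (by simp [stmts₁, stmts₁_self])
    rw [stepAux]
    cases e : y k with
    | nil =>
      rw [update_eq_self_iff.2 (by rw [e]; rfl)]
      exact ih hq' (.meet (.pop_empty s rfl) h (derives_empty e))
    | cons g l =>
      rw [← pushStack_update e] at h
      exact ih hq' (.pop (.pop_top s g rfl) h)
  | load a q ih =>
    exact ih (hT _ hq (by simp [stmts₁, stmts₁_self])) (.meet (.load s rfl) h h)
  | branch p q₁ q₂ ih₁ ih₂ =>
    rw [stepAux]
    cases e : p s with
    | true =>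
      exact ih₁ (hT _ hq (by simp [stmts₁, stmts₁_self])) (.meet (.branch_true s rfl e) h h)
    | false =>
      exact ih₂ (hT _ hq (by simp [stmts₁, stmts₁_self])) (.meet (.branch_false s rfl e) h h)
  | goto l =>
    exact ⟨hgoto l hq s, .meet (.goto s rfl rfl) h h⟩
  | halt => exact .meet (.halt s rfl) h h

/-- The halting problem for a stack machine reduces to derivability from finitely many clauses. -/
theorem exists_clauses_derives_iff [Finite K] [Finite G] [Finite σ] [Inhabited Λ]
    (M : Λ → Stmt (fun _ : K => G) Λ σ) {S : Finset Λ} (hS : Supports M S) (s : σ) :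
    ∃ (ι : Type) (_ : Finite ι) (C : Set (Clause ι K G)) (P₀ bad : ι), ∀ y₀,
      (∃ y, Derives C P₀ y₀ bad y) ↔ (eval (step M) ⟨some default, s, y₀⟩).Dom := by
  let T : Set (Stmt (fun _ : K => G) Λ σ) := {q | some q ∈ stmts M S}
  have hfin : Finite T := (stmts M S).finite_toSet.preimage (Option.some_injective _).injOn
  have := Fintype.ofFinite T
  have := Fintype.ofFinite K
  have := Fintype.ofFinite G
  have := Fintype.ofFinite σ
  have hmem {l : Λ} (hl : l ∈ S) : M l ∈ T := by
    simp only [T, stmts, Set.mem_ofPred_eq, Finset.some_mem_insertNone, Finset.mem_biUnion]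
    exact ⟨l, hl, stmts₁_self⟩
  refine ⟨MachinePred K G T σ, inferInstance, {c | MachineClause M T c}, .stmt ⟨_, hmem hS.1⟩ s,
    .halted, fun y₀ => ⟨?_, fun h => ?_⟩⟩
  · rintro ⟨y, hy⟩
    refine valid_of_derives (c₀ := ⟨some default, s, y₀⟩) ?_ hy
    exact Relation.ReflTransGen.single rfl
  · obtain ⟨c, hc⟩ := Part.dom_iff_mem.1 h
    obtain ⟨hreach, hnone⟩ := mem_eval.1 hc
    have hcfg : DerivesCfg M (.stmt ⟨_, hmem hS.1⟩ s) y₀ c := by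
      clear hc hnone
      induction hreach with
      | refl => exact ⟨hmem hS.1, .start⟩
      | @tail b c _ hbc ih =>
        obtain ⟨_ | l, s', y⟩ := b
        · cases hbc
        · obtain rfl := Option.some.inj hbc
          obtain ⟨hl, hd⟩ := ih
          exact derivesCfg_stepAux (fun q hq q' hq' => stmts_trans hq' hq)
            (fun l hl s => hmem (stmts_supportsStmt hS hl s)) hl hd
    obtain ⟨_ | l, s', y⟩ := c
    · exact ⟨y, hcfg⟩
    · cases hnone

end Machine

section Undecidability

open Turing.PartrecToTM2

/-- Termination of a program can be expressed by inconsistency of conjunctions of lattice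
equations. -/
theorem exists_conj_consistent_iff_not_dom (c : Turing.ToPartrec.Code) :
    ∃ (a b i o p : ℕ) (d : Γ' → ℕ) (Ψ : LatConj), ∀ v : List ℕ,
      (∃ (L : Type) (_ : Lattice L) (_ : IsModularLattice L) (w : ℕ → L),
        LatConj.Sat (leEq (stackTerm a b i o d (trList v)) (.var p) :: Ψ) w ∧
        LatConj.Nontriv (leEq (stackTerm a b i o d (trList v)) (.var p) :: Ψ) w) ↔
      ¬ (c.eval v).Dom := by
  have hfin : Finite K' := by
    refine Finite.of_surjective ![K'.main, .rev, .aux, .stack] ?_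
    rintro (_ | _ | _ | _)
    exacts [⟨0, rfl⟩, ⟨1, rfl⟩, ⟨2, rfl⟩, ⟨3, rfl⟩]
  obtain ⟨ι, _, C, P₀, bad, hC⟩ := @exists_clauses_derives_iff _ _ _ _ _ _ _ _
    ⟨trNormal c .halt⟩ tr _ (tr_supports c .halt) none
  obtain ⟨a, b, i, o, p, d, Ψ, h⟩ := exists_conj_consistent_iff C P₀ bad .main
  refine ⟨a, b, i, o, p, d, Ψ, fun v => (h _).trans ?_⟩
  have hinit : update (fun _ => []) .main (trList v) = K'.elim (trList v) [] [] [] := by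
    funext k
    cases k <;> rfl
  rw [← not_exists, hC, hinit]
  exact not_congr (congrArg Part.Dom (tr_eval c v)).to_iff

lemma trNat_eq {n : ℕ} (hn : n ≠ 0) :
    trNat n = (if n % 2 = 0 then Γ'.bit0 else Γ'.bit1) :: trNat (n / 2) := by
  have key (b : Bool) (m : ℕ) (h : Nat.bit b m ≠ 0) :
      trNat (Nat.bit b m) = (if b then Γ'.bit1 else Γ'.bit0) :: trNat m := by
    simp only [trNat, ← Num.ofNat'_eq, Num.ofNat'_bit]
    rcases e : Num.ofNat' m with _ | q
    · have hm : m = 0 := by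
        rw [← Num.to_of_nat m, ← Num.ofNat'_eq, e]
        rfl
      cases b
      · simp [hm] at h
      · rfl
    · cases b <;> rfl
  have := key n.bodd n.div2
  rw [Nat.bit_bodd_div2, Nat.div2_val] at this
  rw [this hn, Nat.mod_two_of_bodd]
  cases n.bodd <;> rfl

lemma computable_code_conj (a b i o p : ℕ) (d : Γ' → ℕ) (Ψ : LatConj) :
    Computable fun n => LatConj.code (leEq (stackTerm a b i o d (trList [n])) (.var p) :: Ψ) := by
  let F (d x : ℕ) : ℕ := 3 * Nat.pair (3 * Nat.pair (3 * Nat.pair (3 * Nat.pair x (3 * d) + 1)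
    (3 * b) + 2) (3 * i) + 1) (3 * a) + 2
  have three {f : ℕ → ℕ} (hf : Primrec f) : Primrec fun x => 3 * f x :=
    Primrec.nat_mul.comp (.const 3) hf
  have hF (d : ℕ) : Primrec (F d) := by
    refine Primrec.succ.comp (Primrec.succ.comp (three (Primrec₂.natPair.comp (Primrec.succ.comp
      (three (Primrec₂.natPair.comp (Primrec.succ.comp (Primrec.succ.comp
        (three (Primrec₂.natPair.comp (Primrec.succ.comp (three (Primrec₂.natPair.comp .id ?_)))
          ?_))))
      ?_))) ?_)))
    all_goals exact .const _
  let T (n : ℕ) : ℕ := (stackTerm a b i o d (trList [n])).code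
  have hT : Primrec T := by
    let g (_ : Unit) (l : List ℕ) : Option ℕ := if l.length = 0 then some (T 0) else
      (l[l.length / 2]?).map fun x => if l.length % 2 = 0 then F (d .bit0) x else F (d .bit1) x
    have hg : Primrec₂ g := by
      have hlen : Primrec fun x : Unit × List ℕ => x.2.length := Primrec.list_length.comp .snd
      refine Primrec.ite (Primrec.eq.comp hlen (.const 0)) (.const _) (Primrec.option_map
        (Primrec.list_getElem?.comp .snd (Primrec.nat_div.comp hlen (.const 2))) ?_)
      exact Primrec.ite (Primrec.eq.comp (Primrec.nat_mod.comp (hlen.comp .fst) (.const 2))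
        (.const 0)) ((hF _).comp .snd) ((hF _).comp .snd)
    refine (Primrec.nat_strong_rec (fun _ => T) hg fun _ n => ?_).comp (.const ()) .id
    rcases eq_or_ne n 0 with rfl | hn
    · simp [g]
    · have hlt : n / 2 < n := Nat.div_lt_self (Nat.pos_of_ne_zero hn) one_lt_two
      have : T n = if n % 2 = 0 then F (d .bit0) (T (n / 2)) else F (d .bit1) (T (n / 2)) := by
        simp only [T, trList, trNat_eq hn]
        split_ifs <;> rfl
      simp [g, hn, hlt, this]
  have hcode : Primrec fun n => Encodable.encode
      (Nat.pair (3 * Nat.pair (T n) (3 * p) + 2) (T n) ::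
        Ψ.map fun q => Nat.pair q.1.code q.2.code) :=
    Primrec.encode.comp (Primrec.list_cons.comp (Primrec₂.natPair.comp (Primrec.succ.comp
      (Primrec.succ.comp (three (Primrec₂.natPair.comp hT (.const _))))) hT) (.const _))
  exact hcode.to_comp

end Undecidability

end LatticeMachine

/-- The consistency problem for the class of all modular
lattices is unsolvable: no computable function decides (via the Gödel numbering
`LatConj.code`) whether a conjunction of lattice equations admits a non-trivial
satisfying assignment in some modular lattice. -/
theorem modular_lattice_consistency_undecidable :
    ¬ ∃ f : ℕ → Bool, Computable f ∧
      ∀ Φ : LatConj, (f Φ.code = true ↔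
        ∃ (L : Type) (_ : Lattice L) (_ : IsModularLattice L) (v : ℕ → L),
          Φ.Sat v ∧ Φ.Nontriv v) := by
  rintro ⟨f, hf, h⟩
  have hpart : Partrec fun n => (Denumerable.ofNat Nat.Partrec.Code n).eval 0 :=
    Nat.Partrec.Code.eval_part.comp (Computable.ofNat _) (.const 0)
  obtain ⟨c, hc⟩ := Turing.ToPartrec.Code.exists_code (Nat.Partrec'.part_iff₁.2 hpart)
  obtain ⟨a, b, i, o, p, d, Ψ, hΨ⟩ := LatticeMachine.exists_conj_consistent_iff_not_dom c
  refine ComputablePred.halting_problem 0 (ComputablePred.computable_iff.2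
    ⟨fun e => !f (LatConj.code (LatticeMachine.leEq (LatticeMachine.stackTerm a b i o d
      (Turing.PartrecToTM2.trList [Encodable.encode e])) (.var p) :: Ψ)),
      Primrec.not.to_comp.comp (hf.comp
        ((LatticeMachine.computable_code_conj a b i o p d Ψ).comp Computable.encode)), ?_⟩)
  funext e
  have he := hc ⟨[Encodable.encode e], rfl⟩
  rw [Bool.not_eq_true', ← Bool.not_eq_true, h, hΨ, not_not, he]
  simp [List.Vector.head]
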